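/- Suppose ℵ₀ ≤ μ < κ = cf(κ) and there is a cardinal λ with μ < λ ≤ κ such that Δ_{λ,κ} holds. Then any graph of size κ with coloring number > μ has a subgraph of size < κ with coloring number > μ. -/

import Mathlib

open Cardinal

/-- The coloring number of a graph: the least cardinal `c` for which there exists a
well-ordering `r` of the vertices such that every vertex has fewer than `c` neighbors
preceding it in `r`. -/
noncomputable def colNum {V : Type} (G : SimpleGraph V) : Cardinal.{0} :=
  sInf {c : Cardinal.{0} | ∃ r : V → V → Prop, IsWellOrder V r ∧
    ∀ x : V, #{y : V // G.Adj x y ∧ r y x} < c}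

/-- `C` is a club (closed and unbounded) subset of `δ`. -/
def IsClubIn (C : Set Ordinal) (δ : Ordinal) : Prop :=
  C ⊆ Set.Iio δ ∧ (∀ β < δ, ∃ γ ∈ C, β ≤ γ) ∧
    ∀ β < δ, 0 < β → sSup (C ∩ Set.Iio β) = β → β ∈ C

/-- `S` is stationary in `δ`: it meets every club in `δ`. -/
def IsStationaryIn (S : Set Ordinal) (δ : Ordinal) : Prop :=
  ∀ C, IsClubIn C δ → (S ∩ C).Nonempty

/-- The order type of a set of ordinals: the least `j` such that `S` is contained in the
image of `Iio j` under the increasing enumeration of `S`. -/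
noncomputable def otpS (S : Set Ordinal) : Ordinal :=
  sInf {j : Ordinal | S ⊆ Ordinal.enumOrd S '' Set.Iio j}

/-- The Magidor–Shelah reflection principle `Δ_{λ,κ}`: for every stationary
`S ⊆ E^κ_{<λ}` and every algebra on `κ` with fewer than `λ` finitary operations, there is
a subalgebra `A'` whose order type is a regular cardinal `η < λ` such that `S ∩ A'` is
stationary in `sup(A')`. -/
def DeltaRefl (lam κ : Cardinal.{0}) : Prop :=
  ∀ S : Set Ordinal, S ⊆ {α | α < κ.ord ∧ α.cof < lam} → IsStationaryIn S κ.ord →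
  ∀ (ι : Type) (F : ι → Σ n : ℕ, (Fin n → Ordinal) → Ordinal), #ι < lam →
    (∀ i (v : Fin (F i).1 → Ordinal), (∀ j, v j < κ.ord) → (F i).2 v < κ.ord) →
    ∃ A' : Set Ordinal, A' ⊆ Set.Iio κ.ord ∧
      (∀ i (v : Fin (F i).1 → Ordinal), (∀ j, v j ∈ A') → (F i).2 v ∈ A') ∧
      (∃ η : Cardinal.{0}, η.IsRegular ∧ otpS A' = η.ord ∧ η < lam) ∧
      IsStationaryIn (S ∩ A') (sSup A')


theorem colNum_le_iff {V : Type} (G : SimpleGraph V) (μ : Cardinal.{0}) :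
    colNum G ≤ μ ↔ ∃ ρ : V → Ordinal.{0}, Function.Injective ρ ∧
      ∀ x : V, #{y : V // G.Adj x y ∧ ρ y < ρ x} < μ := by
  constructor
  · intro h
    have hne : {c : Cardinal.{0} | ∃ r : V → V → Prop, IsWellOrder V r ∧
        ∀ x : V, #{y : V // G.Adj x y ∧ r y x} < c}.Nonempty := by
      refine ⟨Order.succ #V, WellOrderingRel, inferInstance, fun x => ?_⟩
      exact Order.lt_succ_of_le (mk_subtype_le _)
    obtain ⟨r, hr, hx⟩ := csInf_mem hne
    refine ⟨fun v => Ordinal.typein r v, Ordinal.typein_injective r, fun x => ?_⟩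
    have := hx x
    simp only [Ordinal.typein_lt_typein]
    exact this.trans_le h
  · rintro ⟨ρ, hρ, hx⟩
    refine csInf_le' ⟨fun a b => ρ a < ρ b, ?_, hx⟩
    exact ((RelEmbedding.preimage ⟨ρ, hρ⟩ (· < ·)).isWellOrder)

theorem colNum_le_of_rank {V : Type} {W : Type*} [LinearOrder W] [WellFoundedLT W]
    (G : SimpleGraph V) (μ : Cardinal.{0}) (ρ : V → W) (hρ : Function.Injective ρ)
    (hx : ∀ x : V, #{y : V // G.Adj x y ∧ ρ y < ρ x} < μ) : colNum G ≤ μ := by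
  refine csInf_le' ⟨fun a b => ρ a < ρ b, ?_, hx⟩
  exact ((RelEmbedding.preimage ⟨ρ, hρ⟩ (· < ·)).isWellOrder)

theorem mk_le_card_of_inj {X : Type} (j : X → Ordinal.{0}) (hj : Function.Injective j)
    (o : Ordinal.{0}) (h : ∀ x, j x < o) : #X ≤ o.card := by
  have : Function.Injective (fun x => (⟨j x, h x⟩ : Set.Iio o)) := by
    intro a b hab
    exact hj (congrArg Subtype.val hab)
  have h2 := Cardinal.mk_le_of_injective (f := fun x : ULift.{1} X => (⟨j x.down, h x.down⟩ : Set.Iio o))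
    (fun a b hab => ULift.down_injective (hj (congrArg Subtype.val hab)))
  rw [Cardinal.mk_Iio_ordinal, Cardinal.mk_uLift] at h2
  exact Cardinal.lift_le.1 h2

theorem omega_limit (δ : Ordinal.{0})
    (hb : ∀ f : ℕ → Ordinal.{0}, (∀ n, f n < δ) → ∃ β < δ, ∀ n, f n ≤ β)
    (R : Ordinal.{0} → Ordinal.{0} → Prop)
    (hR : ∀ ρ < δ, ∃ σ < δ, ρ < σ ∧ R ρ σ) (γ : Ordinal.{0}) (hγ : γ < δ) :
    ∃ α < δ, γ < α ∧ α.cof ≤ ℵ₀ ∧ ∀ ρ < α, ∃ σ τ, ρ ≤ σ ∧ σ < τ ∧ τ < α ∧ R σ τ := by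
  choose! f hf using hR
  let s : ℕ → Ordinal.{0} := fun n => f^[n] γ
  have hs : ∀ n, s n < δ := by
    intro n
    induction n with
    | zero => exact hγ
    | succ n ih =>
      simp only [s, Function.iterate_succ_apply']
      exact (hf _ ih).1
  have hsucc : ∀ n, s n < s (n+1) ∧ R (s n) (s (n+1)) := by
    intro n
    have := (hf _ (hs n)).2
    simpa only [s, Function.iterate_succ_apply'] using this
  obtain ⟨β, hβ, hβs⟩ := hb s hs
  have hbdd : BddAbove (Set.range s) := ⟨β, by rintro _ ⟨n, rfl⟩; exact hβs n⟩
  have hlt : ∀ n, s n < iSup s := fun n => (hsucc n).1.trans_le (le_ciSup hbdd (n+1))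
  refine ⟨iSup s, (ciSup_le' hβs).trans_lt hβ, hlt 0, ?_, ?_⟩
  · by_contra! hf
    exact (Ordinal.iSup_lt_of_lt_cof (by simpa using hf) hlt).false
  · intro ρ hρ
    obtain ⟨n, hn⟩ := exists_lt_of_lt_ciSup hρ
    exact ⟨s n, s (n+1), hn.le, (hsucc n).1, hlt _, (hsucc n).2⟩

theorem otp_facts {V : Type} (e : V → Ordinal.{0}) (he : Function.Injective e)
    (A' : Set Ordinal.{0}) (η : Cardinal.{0}) (hη : η.IsRegular)
    (hA : A' ⊆ Set.range e) (ho : otpS A' = η.ord) :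
    #(e ⁻¹' A') ≤ η ∧ η ≤ #(e ⁻¹' A') ∧
      ∀ a : V, e a ∈ A' → #{b : V // e b ∈ A' ∧ e b < e a} < η := by
  have hne : {j : Ordinal.{0} | A' ⊆ Ordinal.enumOrd A' '' Set.Iio j}.Nonempty := by
    by_contra hcon
    rw [Set.not_nonempty_iff_eq_empty] at hcon
    have : otpS A' = 0 := by rw [otpS, hcon, Ordinal.sInf_empty]
    rw [ho] at this
    exact hη.ord_pos.ne' this
  have hmem : A' ⊆ Ordinal.enumOrd A' '' Set.Iio η.ord := by
    have := csInf_mem hne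
    rw [← ho]
    exact this
  have hmin : ∀ j < η.ord, ¬ A' ⊆ Ordinal.enumOrd A' '' Set.Iio j := by
    intro j hj hsub
    rw [← ho] at hj
    exact absurd (csInf_le' (s := {j : Ordinal.{0} | A' ⊆ Ordinal.enumOrd A' '' Set.Iio j}) hsub) (not_le.2 hj)
  have hch : ∀ v : V, e v ∈ A' → ∃ j < η.ord, Ordinal.enumOrd A' j = e v := by
    intro v hv
    obtain ⟨j, hj, hje⟩ := hmem hv
    exact ⟨j, hj, hje⟩
  choose! j hj hje using hch
  refine ⟨?_, ?_, ?_⟩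
  · have := mk_le_card_of_inj (fun x : e ⁻¹' A' => j x) ?_ η.ord (fun x => hj _ x.2)
    · simpa using this
    · intro a b hab
      apply Subtype.ext
      apply he
      rw [← hje _ a.2, ← hje _ b.2]
      exact congrArg _ hab
  · by_contra hlt
    push Not at hlt
    have h1 : (⨆ x : e ⁻¹' A', (j x + 1)) < η.ord :=
      Ordinal.iSup_add_one_lt_of_lt_cof (by rw [hη.cof_ord]; exact hlt) (fun x => hj _ x.2)
    refine hmin _ h1 ?_
    intro a ha
    obtain ⟨v, rfl⟩ := hA ha
    refine ⟨j v, ?_, hje v ha⟩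
    have : j v + 1 ≤ ⨆ x : e ⁻¹' A', (j x + 1) :=
      le_ciSup (f := fun x : e ⁻¹' A' => j x + 1) (Ordinal.bddAbove_of_small) ⟨v, ha⟩
    exact (lt_add_one _).trans_le this
  · intro a ha
    have key : ∀ b : V, e b ∈ A' → e b < e a → e b ≠ 0 → j b < j a := by
      intro b hb hba hb0
      by_contra hcon
      push Not at hcon
      have hT : (A' ∩ {x | ∀ c, c < j b → Ordinal.enumOrd A' c < x}).Nonempty := by
        by_contra hem
        rw [Set.not_nonempty_iff_eq_empty] at hem
        apply hb0
        rw [← hje b hb, Ordinal.enumOrd, hem, Ordinal.sInf_empty]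
      have h1 := csInf_mem hT
      rw [← Ordinal.enumOrd, hje b hb] at h1
      have h2 := Ordinal.enumOrd_le_of_forall_lt (o := j a) hb
        (fun c hc => h1.2 c (hc.trans_le hcon))
      rw [hje a ha] at h2
      exact absurd hba (not_lt.2 h2)
    have hlim : Order.IsSuccLimit η.ord := Cardinal.isSuccLimit_ord hη.aleph0_le
    have : #{b : V // e b ∈ A' ∧ e b < e a} ≤ (j a + 1).card := by
      classical
      refine mk_le_card_of_inj (fun b : {b : V // e b ∈ A' ∧ e b < e a} => if e b = 0 then j a else j b) ?_ _ ?_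
      · rintro ⟨b, hb, hba⟩ ⟨c, hc, hca⟩ hbc
        apply Subtype.ext
        apply he
        simp only at hbc ⊢
        split_ifs at hbc with h1 h2 h2
        · rw [h1, h2]
        · exact absurd hbc (key c hc hca h2).ne'
        · exact absurd hbc (key b hb hba h1).ne
        · rw [← hje b hb, ← hje c hc, hbc]
      · rintro ⟨b, hb, hba⟩
        simp only
        split_ifs with h1
        · exact lt_add_one _
        · exact (key b hb hba h1).trans (lt_add_one _)
    refine this.trans_lt ?_
    rw [← Cardinal.lt_ord]
    exact hlim.add_one_lt (hj a ha)

theorem sup_bdd {V : Type} (e : V → Ordinal.{0}) (he : Function.Injective e)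
    (A' : Set Ordinal.{0}) (η : Cardinal.{0}) (hη : η.IsRegular)
    (hA : A' ⊆ Set.range e) (hbd : BddAbove A') (ho : otpS A' = η.ord)
    : (∀ a, e a ∈ A' → e a < sSup A') ∧
    (∀ σ < sSup A', ∃ v, e v ∈ A' ∧ σ < e v) ∧
    ∀ (X : Type), #X < η → ∀ (f : X → Ordinal.{0}), (∀ x, f x < sSup A') →
    ∃ β < sSup A', ∀ x, f x ≤ β := by
  obtain ⟨h1, h2, h3⟩ := otp_facts e he A' η hη hA ho
  have hT : ∀ U : Set V, #U < η → ∃ t, e t ∈ A' ∧ t ∉ U := by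
    intro U hU
    by_contra hcon
    push Not at hcon
    exact absurd (h2.trans (mk_le_mk_of_subset (t := U) hcon)) (not_le.2 hU)
  have hne : A'.Nonempty := by
    obtain ⟨t, ht, -⟩ := hT ∅ (by simpa using hη.pos)
    exact ⟨_, ht⟩
  have hnomax : ∀ a, e a ∈ A' → e a < sSup A' := by
    intro a ha
    have hc : #(({b : V | e b ∈ A' ∧ e b < e a} ∪ {a} : Set V)) < η := by
      refine (mk_union_le _ _).trans_lt (add_lt_of_lt hη.aleph0_le (h3 a ha) ?_)
      simpa using hη.nat_lt 1
    obtain ⟨t, ht, htn⟩ := hT _ hc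
    simp only [Set.mem_union, Set.mem_ofPred_eq, Set.mem_singleton_iff, not_or, not_and, not_lt] at htn
    have h5 := lt_of_le_of_ne (htn.1 ht) (fun h => htn.2 (he h.symm))
    exact h5.trans_le (le_csSup hbd ht)
  have hw : ∀ σ < sSup A', ∃ v, e v ∈ A' ∧ σ < e v := by
    intro x hx
    obtain ⟨a, ha, hxa⟩ := exists_lt_of_lt_csSup hne hx
    obtain ⟨v, rfl⟩ := hA ha
    exact ⟨v, ha, hxa⟩
  refine ⟨hnomax, hw, fun X hX f hf => ?_⟩
  have hv : ∀ x, ∃ v, e v ∈ A' ∧ f x < e v := fun x => hw _ (hf x)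
  choose v hvA hvf using hv
  have hc : #(⋃ x, {b : V | e b ∈ A' ∧ e b < e (v x)}) < η := by
    refine (mk_iUnion_le_sum_mk).trans_lt (sum_lt_of_isRegular hη hX fun x => h3 _ (hvA x))
  obtain ⟨t, ht, htn⟩ := hT _ hc
  refine ⟨e t, hnomax t ht, fun x => ?_⟩
  simp only [Set.mem_iUnion, not_exists, Set.mem_ofPred_eq, not_and, not_lt] at htn
  exact (hvf x).le.trans (htn x ht)

theorem part_one (μ κ lam : Cardinal.{0}) (hμinf : ℵ₀ ≤ μ) (hκreg : κ.IsRegular)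
    (hμl : μ < lam) (hlκ : lam ≤ κ) (V : Type) (G : SimpleGraph V) (e : V → Ordinal.{0})
    (he : Function.Injective e) (helt : ∀ v, e v < κ.ord)
    (hsmall : ∀ A : Set V, #A < κ → colNum (G.induce A) ≤ μ)
    (C : Set Ordinal.{0}) (hC : IsClubIn C κ.ord)
    (hdisj : ∀ α ∈ C, α.cof < lam → ∀ x, α ≤ e x → #{y : V // G.Adj x y ∧ e y < α} < μ) :
    colNum G ≤ μ := by
  classical
  have hμ0 : 0 < μ := aleph0_pos.trans_le hμinf
  let L : Set Ordinal.{0} := {α | ∀ ρ < α, ∃ c ∈ C, ρ < c ∧ c < α}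
  have hLC : ∀ α ∈ L, 0 < α → α < κ.ord → α ∈ C := by
    intro α hα h0 hlt
    refine hC.2.2 α hlt h0 (le_antisymm (csSup_le' fun c hc => hc.2.le) ?_)
    refine le_of_forall_lt fun ρ hρ => ?_
    obtain ⟨c, hc, h1, h2⟩ := hα ρ hρ
    exact h1.trans_le (le_csSup ⟨α, fun c hc => hc.2.le⟩ ⟨hc, h2⟩)
  have hκL : κ.ord ∈ L := by
    intro ρ hρ
    have hlim : Order.IsSuccLimit κ.ord := Cardinal.isSuccLimit_ord hκreg.aleph0_le
    obtain ⟨c, hc, h1⟩ := hC.2.1 (ρ + 1) (hlim.add_one_lt hρ)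
    exact ⟨c, hc, (lt_add_one _).trans_le h1, hC.1 hc⟩
  have hgen : ∀ δ ∈ L, ℵ₀ < δ.cof → ∀ γ < δ, ∃ α ∈ L, γ < α ∧ α < δ ∧ α.cof ≤ ℵ₀ := by
    intro δ hδ hcof γ hγ
    obtain ⟨α, h1, h2, h3, h4⟩ := omega_limit δ (fun f hf => ⟨⨆ n, f n,
      Ordinal.iSup_lt_of_lt_cof (by simpa using hcof) hf,
      fun n => le_ciSup (Ordinal.bddAbove_of_small) n⟩) (fun _ τ => τ ∈ C)
      (fun ρ hρ => by
        obtain ⟨c, hc, h1, h2⟩ := hδ ρ hρ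
        exact ⟨c, h2, h1, hc⟩) γ hγ
    refine ⟨α, ?_, h2, h1, h3⟩
    intro ρ hρ
    obtain ⟨σ, τ, h5, h6, h7, h8⟩ := h4 ρ hρ
    exact ⟨τ, h8, h5.trans_lt h6, h7⟩
  have hfew : ∀ δ ∈ L, ∀ x, δ ≤ e x → #{y : V // G.Adj x y ∧ e y < δ} < μ := by
    intro δ hδ x hx
    have hδκ : δ < κ.ord := hx.trans_lt (helt x)
    rcases eq_zero_or_pos δ with h0 | h0
    · have : IsEmpty {y : V // G.Adj x y ∧ e y < δ} := by
        subst h0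
        exact ⟨fun y => not_lt_zero y.2.2⟩
      rw [mk_eq_zero]
      exact hμ0
    by_cases hcof : δ.cof < lam
    · exact hdisj δ (hLC δ hδ h0 hδκ) hcof x hx
    push Not at hcof
    by_contra hcon
    push Not at hcon
    rw [← Cardinal.mk_out μ, Cardinal.le_def] at hcon
    obtain ⟨i⟩ := hcon
    have hσ : (⨆ k, e (i k).1) < δ :=
      Ordinal.iSup_lt_of_lt_cof (by rw [mk_out]; exact hμl.trans_le hcof) (fun k => (i k).2.2)
    obtain ⟨α, hα, h1, h2, h3⟩ := hgen δ hδ ((hμinf.trans_lt hμl).trans_le hcof) _ hσ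
    have h4 := hdisj α (hLC α hα (bot_le.trans_lt h1) (h2.trans hδκ))
      (h3.trans_lt (hμinf.trans_lt hμl)) x (h2.le.trans hx)
    refine absurd h4 (not_lt.2 ?_)
    rw [← Cardinal.mk_out μ]
    refine Cardinal.mk_le_of_injective (f := fun k => ⟨(i k).1, (i k).2.1,
      (le_ciSup (f := fun k => e (i k).1) (Ordinal.bddAbove_of_small) k).trans_lt h1⟩) ?_
    intro a b hab
    have hab' := congrArg Subtype.val hab
    exact i.injective (Subtype.ext hab')
  let c : V → Ordinal.{0} := fun v => sSup (L ∩ Set.Iic (e v))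
  have hcle : ∀ v, c v ≤ e v := fun v => csSup_le' fun d hd => hd.2
  have hcmax : ∀ v, ∀ d ∈ L, d ≤ e v → d ≤ c v := fun v d hd hdv =>
    le_csSup ⟨e v, fun d hd => hd.2⟩ ⟨hd, hdv⟩
  have hcL : ∀ v, c v ∈ L := by
    intro v ρ hρ
    have hne : (L ∩ Set.Iic (e v)).Nonempty :=
      ⟨0, fun ρ hρ => absurd hρ not_lt_zero, Set.mem_Iic.2 zero_le⟩
    obtain ⟨d, hd, h1⟩ := exists_lt_of_lt_csSup hne hρ
    obtain ⟨k, hk, h2, h3⟩ := hd.1 ρ h1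
    exact ⟨k, hk, h2, h3.trans_le (hcmax v d hd.1 hd.2)⟩
  have hblock : ∀ γ : Ordinal.{0}, γ < κ.ord → ∃ ρ : V → Ordinal.{0},
      (∀ x y, c x = γ → c y = γ → ρ x = ρ y → x = y) ∧
      ∀ x, c x = γ → #{y : V // G.Adj x y ∧ c y = γ ∧ ρ y < ρ x} < μ := by
    intro γ hγ
    have hB : #{v | c v = γ} < κ := by
      obtain ⟨α, hα, h1, h2, -⟩ := hgen κ.ord hκL
        (by rw [hκreg.cof_ord]; exact (hμinf.trans_lt hμl).trans_le hlκ) γ hγ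
      refine (mk_le_card_of_inj (fun v : {v | c v = γ} => e v)
        (fun a b hab => Subtype.ext (he hab)) α ?_).trans_lt (Cardinal.lt_ord.1 h2)
      rintro ⟨v, hv⟩
      by_contra hcon
      have h3 := hcmax v α hα (not_lt.1 hcon)
      have hv' : c v = γ := hv
      rw [hv'] at h3
      exact absurd h1 (not_lt.2 h3)
    obtain ⟨ρ, hρ, hx⟩ := (colNum_le_iff _ _).1 (hsmall _ hB)
    refine ⟨fun v => if h : c v = γ then ρ ⟨v, h⟩ else 0, ?_, ?_⟩
    · intro x y hcx hcy hxy
      simp only [hcx, hcy, dif_pos] at hxy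
      exact congrArg Subtype.val (hρ hxy)
    · intro x hcx
      refine lt_of_le_of_lt ?_ (hx ⟨x, hcx⟩)
      refine Cardinal.mk_le_of_injective (f := fun y => ⟨⟨y.1, y.2.2.1⟩, ?_, ?_⟩) ?_
      · exact y.2.1
      · have := y.2.2.2
        simpa only [hcx, y.2.2.1, dif_pos] using this
      · intro a b hab
        exact Subtype.ext (congrArg (fun z => z.1.1) hab)
  choose! ρ hρinj hρ using hblock
  have hcκ : ∀ v, c v < κ.ord := fun v => (hcle v).trans_lt (helt v)
  refine colNum_le_of_rank G μ (fun v => toLex (c v, ρ (c v) v)) ?_ ?_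
  · intro a b hab
    have h1 := congrArg (fun z => (ofLex z).1) hab
    have h2 := congrArg (fun z => (ofLex z).2) hab
    simp only [ofLex_toLex] at h1 h2
    rw [h1] at h2
    exact hρinj (c b) (hcκ b) a b h1 rfl h2
  · intro x
    have hsub : {y : V | G.Adj x y ∧ toLex (c y, ρ (c y) y) < toLex (c x, ρ (c x) x)} ⊆
        {y | G.Adj x y ∧ e y < c x} ∪ {y | G.Adj x y ∧ c y = c x ∧ ρ (c x) y < ρ (c x) x} := by
      rintro y ⟨hadj, hlt⟩
      rw [Prod.Lex.toLex_lt_toLex] at hlt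
      rcases hlt with h | ⟨h, h'⟩
      · left
        refine ⟨hadj, ?_⟩
        by_contra hcon
        exact absurd h (not_lt.2 (hcmax y _ (hcL x) (not_lt.1 hcon)))
      · right
        simp only at h h'
        refine ⟨hadj, h, ?_⟩
        rwa [h] at h'
    refine (mk_le_mk_of_subset hsub).trans_lt ((mk_union_le _ _).trans_lt ?_)
    exact add_lt_of_lt hμinf (hfew _ (hcL x) x (hcle x)) (hρ (c x) (hcκ x) x rfl)

theorem statement6 (μ κ : Cardinal.{0}) (hμinf : ℵ₀ ≤ μ) (hμκ : μ < κ)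
    (hκreg : κ.IsRegular)
    (hΔ : ∃ lam : Cardinal.{0}, μ < lam ∧ lam ≤ κ ∧ DeltaRefl lam κ)
    (V : Type) (G : SimpleGraph V) (hV : #V = κ) (hcol : μ < colNum G) :
    ∃ (A : Set V) (G' : SimpleGraph A), (∀ x y : A, G'.Adj x y → G.Adj ↑x ↑y) ∧
      #A < κ ∧ μ < colNum G' := by
  by_contra hcon
  push Not at hcon
  have hsmall : ∀ A : Set V, #A < κ → colNum (G.induce A) ≤ μ := fun A hA =>
    hcon A (G.induce A) (fun x y h => h) hA
  obtain ⟨lam, hμl, hlκ, hΔ⟩ := hΔ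
  obtain ⟨e, he, helt, hsurj⟩ : ∃ e : V → Ordinal.{0}, Function.Injective e ∧
      (∀ v, e v < κ.ord) ∧ Set.Iio κ.ord ⊆ Set.range e := by
    obtain ⟨r, hr, hor⟩ := Cardinal.exists_ord_eq V
    rw [hV] at hor
    refine ⟨fun v => Ordinal.typein r v, Ordinal.typein_injective r, fun v => ?_, fun o ho => ?_⟩
    · rw [hor]
      exact Ordinal.typein_lt_type r v
    · rw [hor] at ho
      exact Ordinal.typein_surj r ho
  have hμ0 : 0 < μ := aleph0_pos.trans_le hμinf
  let S : Set Ordinal.{0} := {α | (α < κ.ord ∧ α.cof < lam) ∧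
    ∃ x, α ≤ e x ∧ μ ≤ #{y : V // G.Adj x y ∧ e y < α}}
  have hS : IsStationaryIn S κ.ord := by
    intro C hC
    by_contra hne
    rw [Set.not_nonempty_iff_eq_empty] at hne
    refine absurd (part_one μ κ lam hμinf hκreg hμl hlκ V G e he helt hsmall C hC ?_)
      (not_le.2 hcol)
    intro α hα hcof x hx
    by_contra hge
    have : α ∈ S ∩ C := ⟨⟨⟨hC.1 hα, hcof⟩, x, hx, not_lt.1 hge⟩, hα⟩
    rw [hne] at this
    exact this
  have hch : ∀ α, α ∈ S → ∃ (x : V) (g : μ.out → V), α ≤ e x ∧ Function.Injective g ∧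
      ∀ i, G.Adj x (g i) ∧ e (g i) < α := by
    rintro α ⟨-, x, hx, hge⟩
    rw [← Cardinal.mk_out μ, Cardinal.le_def] at hge
    obtain ⟨i⟩ := hge
    exact ⟨x, fun k => (i k).1, hx, fun a b hab => i.injective (Subtype.ext hab),
      fun k => (i k).2⟩
  have hVne : Nonempty V := by
    rw [← mk_ne_zero_iff, hV]
    exact hκreg.pos.ne'
  choose! b g hb hginj hg using hch
  obtain ⟨A', hA'κ, hA'cl, ⟨η, hη, hηo, hηl⟩, hst⟩ := hΔ S (fun α hα => hα.1) hS (Option μ.out)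
    (fun i => match i with
      | none => ⟨1, fun v => e (b (v 0))⟩
      | some i => ⟨1, fun v => e (g (v 0) i)⟩)
    (by
      rw [mk_option, mk_out, add_one_eq hμinf]
      exact hμl)
    (by
      rintro (_ | i) v -
      · exact helt _
      · exact helt _)
  have hbA : ∀ α ∈ A', e (b α) ∈ A' := fun α hα => hA'cl none (fun _ => α) (fun _ => hα)
  have hgA : ∀ α ∈ A', ∀ i, e (g α i) ∈ A' := fun α hα i =>
    hA'cl (some i) (fun _ => α) (fun _ => hα)
  have hAr : A' ⊆ Set.range e := hA'κ.trans hsurj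
  have hbd : BddAbove A' := ⟨κ.ord, fun a ha => (hA'κ ha).le⟩
  obtain ⟨hT1, -, hT3⟩ := otp_facts e he A' η hη hAr hηo
  obtain ⟨hnomax, habove, hbound⟩ := sup_bdd e he A' η hη hAr hbd hηo
  -- `η > μ`
  have hμη : μ < η := by
    obtain ⟨α, ⟨hαS, hαA⟩, -⟩ := hst (Set.Iio (sSup A'))
      ⟨subset_rfl, fun β hβ => ⟨β, hβ, le_rfl⟩, fun β hβ _ _ => hβ⟩
    obtain ⟨a, rfl⟩ := hAr hαA
    refine lt_of_le_of_lt ?_ (hT3 a hαA)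
    rw [← Cardinal.mk_out μ]
    refine Cardinal.mk_le_of_injective
      (f := fun i => ⟨g (e a) i, hgA _ hαA i, (hg _ hαS i).2⟩) ?_
    intro i j hij
    exact hginj _ hαS (congrArg Subtype.val hij)
  obtain ⟨ρ, hρ, hρx⟩ := (colNum_le_iff _ _).1
    (hsmall (e ⁻¹' A') (hT1.trans_lt (hηl.trans_le hlκ)))
  let D : Set Ordinal.{0} := {δ | δ < sSup A' ∧ ∀ x y : (e ⁻¹' A' : Set V), e x < δ →
    G.Adj x y → ρ y < ρ x → e y < δ}
  have hD : IsClubIn D (sSup A') := by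
    refine ⟨fun δ hδ => hδ.1, ?_, ?_⟩
    · intro β hβ
      obtain ⟨α, h1, h2, -, h4⟩ := omega_limit (sSup A')
        (fun f hf => hbound ℕ (by simpa using hμinf.trans_lt hμη) f hf)
        (fun σ τ => ∀ x y : (e ⁻¹' A' : Set V), e x ≤ σ → G.Adj x y → ρ y < ρ x → e y ≤ τ)
        (by
          intro σ hσ
          obtain ⟨v, hvA, hσv⟩ := habove σ hσ
          have hc : #{x : (e ⁻¹' A' : Set V) // e x ≤ σ} < η := by
            refine lt_of_le_of_lt ?_ (hT3 v hvA)
            refine Cardinal.mk_le_of_injective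
              (f := fun x => ⟨x.1.1, x.1.2, x.2.trans_lt hσv⟩) ?_
            intro x y hxy
            have hxy' := congrArg Subtype.val hxy
            exact Subtype.ext (Subtype.ext hxy')
          have hc2 : #(Σ x : {x : (e ⁻¹' A' : Set V) // e x ≤ σ},
              {y : (e ⁻¹' A' : Set V) // (G.induce (e ⁻¹' A')).Adj x y ∧ ρ y < ρ x}) < η := by
            rw [mk_sigma]
            exact sum_lt_of_isRegular hη hc fun x => (hρx x).trans hμη
          obtain ⟨β, hβ, hβx⟩ := hbound _ hc2 (fun p => e p.2.1) (fun p => hnomax _ p.2.1.2)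
          refine ⟨max β (e v), max_lt hβ (hnomax v hvA), lt_max_of_lt_right hσv, ?_⟩
          intro x y hx hadj hlt
          exact (hβx ⟨⟨x, hx⟩, ⟨y, hadj, hlt⟩⟩).trans (le_max_left _ _)) β hβ
      refine ⟨α, ⟨h1, ?_⟩, h2.le⟩
      intro x y hx hadj hlt
      obtain ⟨σ, τ, h5, h6, h7, h8⟩ := h4 _ hx
      exact (h8 x y h5 hadj hlt).trans_lt h7
    · intro β hβ h0 hsup
      refine ⟨hβ, fun x y hx hadj hlt => ?_⟩
      have hne : (D ∩ Set.Iio β).Nonempty := by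
        by_contra hem
        rw [Set.not_nonempty_iff_eq_empty] at hem
        rw [hem, csSup_empty] at hsup
        exact h0.ne (by simpa using hsup)
      rw [← hsup] at hx
      obtain ⟨d, hd, hxd⟩ := exists_lt_of_lt_csSup hne hx
      exact (hd.1.2 x y hxd hadj hlt).trans hd.2
  obtain ⟨α, ⟨hαS, hαA⟩, hαD⟩ := hst D hD
  refine absurd (hρx ⟨b α, hbA α hαA⟩) (not_lt.2 ?_)
  rw [← Cardinal.mk_out μ]
  refine Cardinal.mk_le_of_injective
    (f := fun i => ⟨⟨g α i, hgA α hαA i⟩, (hg α hαS i).1, ?_⟩) ?_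
  · by_contra hge
    have hne : ρ ⟨g α i, hgA α hαA i⟩ ≠ ρ ⟨b α, hbA α hαA⟩ := by
      intro h
      have := congrArg Subtype.val (hρ h)
      exact (hg α hαS i).1.ne this.symm
    have hlt := lt_of_le_of_ne (not_lt.1 hge) hne.symm
    have := hαD.2 ⟨g α i, hgA α hαA i⟩ ⟨b α, hbA α hαA⟩ (hg α hαS i).2 (hg α hαS i).1.symm hlt
    exact absurd this (not_lt.2 (hb α hαS))
  · intro i j hij
    exact hginj α hαS (congrArg (fun z => z.1.1) hij)
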